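/- For every local good semigroup S ⊆ ℕ², the genus, type, and length satisfy g(S) ≥ t(S) + l(S) − 1. -/

import Mathlib

/-- The ambient space `ℤ²`; `ℕ²` is identified with the nonnegative orthant. -/
abbrev Z2 : Type := ℤ × ℤ

/-- The nonnegative orthant, representing `ℕ² ⊆ ℤ²`. -/
def orth : Set Z2 := {a : Z2 | 0 ≤ a.1 ∧ 0 ≤ a.2}

/-- Property (G1): closure under componentwise minimum. -/
def MinClosed (E : Set Z2) : Prop := ∀ a ∈ E, ∀ b ∈ E, a ⊓ b ∈ E

/-- Property (G3). -/
def G3P (E : Set Z2) : Prop :=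
  ∀ a ∈ E, ∀ b ∈ E, a ≠ b →
    (a.1 = b.1 →
      ∃ e ∈ E, a.1 < e.1 ∧ min a.2 b.2 ≤ e.2 ∧ (a.2 ≠ b.2 → e.2 = min a.2 b.2)) ∧
    (a.2 = b.2 →
      ∃ e ∈ E, a.2 < e.2 ∧ min a.1 b.1 ≤ e.1 ∧ (a.1 ≠ b.1 → e.1 = min a.1 b.1))

/-- A good semigroup of `ℕ²` (viewed inside `ℤ²`). -/
def IsGood (S : Set Z2) : Prop :=
  S ⊆ orth ∧ (0 : Z2) ∈ S ∧ (∀ a ∈ S, ∀ b ∈ S, a + b ∈ S) ∧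
  MinClosed S ∧ (∃ δ : Z2, ∀ y : Z2, δ ≤ y → y ∈ S) ∧ G3P S

/-- A good semigroup is local if its only element with a zero coordinate is `0`. -/
def IsLocal (S : Set Z2) : Prop := ∀ a ∈ S, (a.1 = 0 ∨ a.2 = 0) → a = 0

/-- A relative good ideal of `S`. -/
def IsRelGoodIdeal (S E : Set Z2) : Prop :=
  E.Nonempty ∧ (∀ e ∈ E, ∀ s ∈ S, e + s ∈ E) ∧ (∃ a ∈ S, ∀ e ∈ E, a + e ∈ S) ∧
  MinClosed E ∧ G3P E

/-- A saturated chain of length `n` in `E`. -/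
def IsSatChain (E : Set Z2) (n : ℕ) (f : ℕ → Z2) : Prop :=
  (∀ i ≤ n, f i ∈ E) ∧ (∀ i < n, f i < f (i + 1)) ∧
  (∀ i < n, ∀ c ∈ E, ¬ (f i < c ∧ c < f (i + 1)))

/-- `d_E(a,b)`: the common length of all saturated chains in `E` from `a` to `b`. -/
noncomputable def chainDist (E : Set Z2) (a b : Z2) : ℕ :=
  sSup {n : ℕ | ∃ f : ℕ → Z2, IsSatChain E n f ∧ f 0 = a ∧ f n = b}

/-- The (componentwise) minimal element `e(E)` of `E`. -/
noncomputable def minEl (E : Set Z2) : Z2 :=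
  (sInf (Prod.fst '' E), sInf (Prod.snd '' E))

/-- The distance `d(E∖F)` between `F ⊆ E`: the common value of
`d_E(e(E),α) - d_F(e(F),α)` for all sufficiently large `α ∈ F`. -/
noncomputable def dist2 (E F : Set Z2) : ℤ :=
  sSup {z : ℤ | ∃ β : Z2, ∀ α ∈ F, β ≤ α →
    (chainDist E (minEl E) α : ℤ) - (chainDist F (minEl F) α : ℤ) = z}

/-- The conductor `c(E)`: the componentwise minimal `δ` with `δ + ℕ² ⊆ E`. -/
noncomputable def condE (E : Set Z2) : Z2 :=
  (sInf ((fun δ : Z2 => δ.1) '' {δ : Z2 | ∀ y : Z2, δ ≤ y → y ∈ E}),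
   sInf ((fun δ : Z2 => δ.2) '' {δ : Z2 | ∀ y : Z2, δ ≤ y → y ∈ E}))

/-- The conductor ideal `C(E) = {β ∈ E : β ≥ c(E)}`. -/
noncomputable def CIdeal (E : Set Z2) : Set Z2 := {b ∈ E | condE E ≤ b}

/-- The length `l(E) = d(E ∖ C(E))`. -/
noncomputable def glen (E : Set Z2) : ℤ := dist2 E (CIdeal E)

/-- The genus `g(E) = d(ℕ² ∖ E)`. -/
noncomputable def genus (E : Set Z2) : ℤ := dist2 orth E

/-- The good semigroup `ℕ²(1,1) = {0} ∪ ((1,1) + ℕ²)`. -/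
def N2oneone : Set Z2 := {a : Z2 | a = 0 ∨ ((1 : ℤ), (1 : ℤ)) ≤ a}
/-- `a ≪ b`: both coordinates strictly smaller. -/
def llt (a b : Z2) : Prop := a.1 < b.1 ∧ a.2 < b.2

/-- `B`: the elements of `R` that are maximal with respect to `≤≤`. -/
def Bof (R : Set Z2) : Set Z2 := {a ∈ R | ∀ b ∈ R, ¬ llt a b}

/-- `C`: the elements of `B` expressible as the componentwise minimum of two
other elements of `B`. -/
def Cof (B : Set Z2) : Set Z2 :=
  {a ∈ B | ∃ b ∈ B, ∃ c ∈ B, b ≠ a ∧ c ≠ a ∧ a = b ⊓ c}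

/-- One step of the level construction: `D = B ∖ C`. -/
def Dof (R : Set Z2) : Set Z2 := Bof R \ Cof (Bof R)

/-- `NLrem A i = D^(1) ∪ ⋯ ∪ D^(i)`: the union of the first `i` levels of `A`. -/
def NLrem (A : Set Z2) : ℕ → Set Z2
  | 0 => ∅
  | i + 1 => NLrem A i ∪ Dof (A \ NLrem A i)

/-- `NL(A)`: the number of levels of `A`, i.e. the least `N` with
`A = D^(1) ∪ ⋯ ∪ D^(N)`. -/
noncomputable def NL (A : Set Z2) : ℕ := sInf {N : ℕ | A ⊆ NLrem A N}

/-- The pseudo-Frobenius elements `PF(S) = {α ∈ ℕ²∖S : α + M ⊆ S}`. -/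
def PFset (S : Set Z2) : Set Z2 :=
  {a : Z2 | a ∈ orth ∧ a ∉ S ∧ ∀ m ∈ S, m ≠ 0 → a + m ∈ S}

/-- The type `t(S) = NL(PF(S))`. -/
noncomputable def typ (S : Set Z2) : ℕ := NL (PFset S)

/-- `L` is a level function of `E`: along every unit step it grows by one if `E` has an element
in the strip crossed by the step, and is constant otherwise. -/
structure IsLevelFn (E : Set Z2) (L : ℤ → ℤ → ℤ) : Prop where
  fst_hit : ∀ x y z, y ≤ z → (x, z) ∈ E → L (x + 1) y = L x y + 1
  fst_miss : ∀ x y, (∀ z, y ≤ z → (x, z) ∉ E) → L (x + 1) y = L x y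
  snd_hit : ∀ x y z, x ≤ z → (z, y) ∈ E → L x (y + 1) = L x y + 1
  snd_miss : ∀ x y, (∀ z, x ≤ z → (z, y) ∉ E) → L x (y + 1) = L x y

theorem Int.eq_of_forall_succ_eq {f : ℤ → ℤ} {a b : ℤ} (hab : a ≤ b)
    (h : ∀ x, a ≤ x → x < b → f (x + 1) = f x) : f b = f a := by
  induction b, hab using Int.leInduction with
  | base => rfl
  | succ n hn ih =>
    rw [h n hn (by omega)]
    exact ih fun x hx hxn => h x hx (by omega)

theorem isLevelFn_orthant (c : Z2) :
    IsLevelFn (Set.Ici c) fun x y => max (x - c.1) 0 + max (y - c.2) 0 := by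
  refine ⟨fun x y z hz h => ?_, fun x y h => ?_, fun x y z hz h => ?_, fun x y h => ?_⟩
  · obtain ⟨h1, h2⟩ := h
    dsimp only at *
    omega
  · have := h (max y c.2) (le_max_left _ _)
    simp only [Set.mem_Ici, Prod.le_def] at this
    omega
  · obtain ⟨h1, h2⟩ := h
    dsimp only at *
    omega
  · have := h (max x c.1) (le_max_left _ _)
    simp only [Set.mem_Ici, Prod.le_def] at this
    omega

/-- The two paths around a unit square cross the same number of occupied strips. -/
theorem G3P.square {E : Set Z2} (hE : G3P E) (x y : ℤ) (h : (x, y) ∈ E) :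
    (∃ z, y + 1 ≤ z ∧ (x, z) ∈ E) ↔ ∃ w, x + 1 ≤ w ∧ (w, y) ∈ E := by
  constructor
  · rintro ⟨z, hz, hzE⟩
    obtain ⟨⟨e1, e2⟩, he, h1, -, h3⟩ :=
      (hE _ h _ hzE (by simp only [ne_eq, Prod.mk.injEq]; omega)).1 rfl
    dsimp only at *
    have : e2 = y := by rw [h3 (by omega)]; omega
    exact ⟨e1, by omega, this ▸ he⟩
  · rintro ⟨z, hz, hzE⟩
    obtain ⟨⟨e1, e2⟩, he, h1, -, h3⟩ :=
      (hE _ h _ hzE (by simp only [ne_eq, Prod.mk.injEq]; omega)).2 rfl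
    dsimp only at *
    have : e1 = x := by rw [h3 (by omega)]; omega
    exact ⟨e2, by omega, this ▸ he⟩

open Classical in
theorem G3P.exists_isLevelFn {E : Set Z2} (hE : G3P E) (h0 : E ⊆ orth) :
    ∃ L, IsLevelFn E L := by
  let p : ℤ → ℤ → ℤ := fun x y => if ∃ z, y ≤ z ∧ (x, z) ∈ E then 1 else 0
  let q : ℤ → ℤ → ℤ := fun x y => if ∃ z, x ≤ z ∧ (z, y) ∈ E then 1 else 0
  let L : ℤ → ℤ → ℤ := fun x y => ∑ i ∈ Finset.Ico 0 x, p i 0 + ∑ j ∈ Finset.Ico 0 y, q x j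
  have square : ∀ x y, p x y + q (x + 1) y = q x y + p x (y + 1) := by
    intro x y
    have key : (x, y) ∉ E → (p x y = p x (y + 1) ∧ q (x + 1) y = q x y) := by
      intro h
      have h1 : (∃ z, y ≤ z ∧ (x, z) ∈ E) ↔ ∃ z, y + 1 ≤ z ∧ (x, z) ∈ E := by
        constructor
        · rintro ⟨z, hz, hzE⟩
          refine ⟨z, ?_, hzE⟩
          rcases hz.lt_or_eq with hlt | rfl
          · omega
          · exact absurd hzE h
        · rintro ⟨z, hz, hzE⟩
          exact ⟨z, by omega, hzE⟩
      have h2 : (∃ z, x + 1 ≤ z ∧ (z, y) ∈ E) ↔ ∃ z, x ≤ z ∧ (z, y) ∈ E := by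
        constructor
        · rintro ⟨z, hz, hzE⟩
          exact ⟨z, by omega, hzE⟩
        · rintro ⟨z, hz, hzE⟩
          refine ⟨z, ?_, hzE⟩
          rcases hz.lt_or_eq with hlt | rfl
          · omega
          · exact absurd hzE h
      simp only [p, q, h1, h2, and_self]
    by_cases h : (x, y) ∈ E
    · have h1 : p x y = 1 := if_pos ⟨y, le_rfl, h⟩
      have h2 : q x y = 1 := if_pos ⟨x, le_rfl, h⟩
      have h3 : q (x + 1) y = p x (y + 1) := by
        simp only [p, q, hE.square x y h]
      omega
    · obtain ⟨h1, h2⟩ := key h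
      omega
  have Ico_succ : ∀ n : ℤ, 0 ≤ n → Finset.Ico 0 (n + 1) = insert n (Finset.Ico 0 n) := by
    intro n hn
    ext
    simp only [Finset.mem_Ico, Finset.mem_insert]
    omega
  have snd_step : ∀ x y, L x (y + 1) = L x y + q x y := by
    intro x y
    by_cases hy : 0 ≤ y
    · simp only [L]
      rw [Ico_succ y hy, Finset.sum_insert (by simp)]
      ring
    · have : q x y = 0 := if_neg fun ⟨z, _, hz⟩ => hy (h0 hz).2
      simp only [L, this]
      rw [Finset.Ico_eq_empty (b := y + 1) (by omega), Finset.Ico_eq_empty (b := y) (by omega)]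
      simp
  have p_neg : ∀ x y, y ≤ 0 → p x y = p x 0 := by
    intro x y hy
    have : (∃ z, y ≤ z ∧ (x, z) ∈ E) ↔ ∃ z, 0 ≤ z ∧ (x, z) ∈ E :=
      ⟨fun ⟨z, _, hz⟩ => ⟨z, (h0 hz).2, hz⟩, fun ⟨z, h, hz⟩ => ⟨z, by omega, hz⟩⟩
    simp only [p, this]
  have fst_step_low : ∀ x y, y ≤ 0 → L (x + 1) y = L x y + p x y := by
    intro x y hy
    rw [p_neg x y hy]
    simp only [L]
    rw [Finset.Ico_eq_empty (a := 0) (b := y) (by omega)]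
    simp only [Finset.sum_empty, add_zero]
    by_cases hx : 0 ≤ x
    · rw [Ico_succ x hx, Finset.sum_insert (by simp), add_comm]
    · have : p x 0 = 0 := if_neg fun ⟨z, _, hz⟩ => hx (h0 hz).1
      rw [this, Finset.Ico_eq_empty (by omega), Finset.Ico_eq_empty (by omega)]
      simp
  have fst_step : ∀ x y, L (x + 1) y = L x y + p x y := by
    intro x y
    rcases le_total y 0 with hy | hy
    · exact fst_step_low x y hy
    · induction y, hy using Int.leInduction with
      | base => exact fst_step_low x 0 le_rfl
      | succ n hn ih =>
        have := square x n
        rw [snd_step, snd_step, ih]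
        omega
  refine ⟨L, fun x y z hz h => ?_, fun x y h => ?_, fun x y z hz h => ?_, fun x y h => ?_⟩
  · rw [fst_step, show p x y = 1 from if_pos ⟨z, hz, h⟩]
  · rw [fst_step, show p x y = 0 from if_neg fun ⟨z, hz, h'⟩ => h z hz h', add_zero]
  · rw [snd_step, show q x y = 1 from if_pos ⟨z, hz, h⟩]
  · rw [snd_step, show q x y = 0 from if_neg fun ⟨z, hz, h'⟩ => h z hz h', add_zero]

theorem IsLevelFn.eq_add_one_of_consecutive {E : Set Z2} {L : ℤ → ℤ → ℤ} (hL : IsLevelFn E L)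
    (hmin : MinClosed E) {a b : Z2} (ha : a ∈ E) (hb : b ∈ E) (hab : a < b)
    (hcons : ∀ c ∈ E, ¬ (a < c ∧ c < b)) : L b.1 b.2 = L a.1 a.2 + 1 := by
  obtain ⟨a1, a2⟩ := a
  obtain ⟨b1, b2⟩ := b
  simp only [Prod.lt_iff, Prod.forall] at hab hcons
  dsimp only at *
  have vert : ∀ j, a2 ≤ j → j < b2 → (a1 < b1 ∨ a2 < j) → L b1 (j + 1) = L b1 j := by
    intro j hj hjb hor
    refine hL.snd_miss _ _ fun z hz hzE => ?_
    have := hmin _ hzE _ hb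
    rw [Prod.mk_inf_mk, inf_eq_right.2 hz, inf_eq_left.2 hjb.le] at this
    exact hcons _ _ this (by omega)
  rcases eq_or_lt_of_le (show a1 ≤ b1 by omega) with rfl | h1
  · have h2 : a2 < b2 := by omega
    rw [← hL.snd_hit a1 a2 a1 le_rfl ha]
    exact Int.eq_of_forall_succ_eq (f := L a1) (by omega)
      fun j hj hjb => vert j (by omega) hjb (by omega)
  · rw [← hL.fst_hit a1 a2 a2 le_rfl ha]
    trans L b1 a2
    · exact Int.eq_of_forall_succ_eq (f := L b1) (by omega)
        fun j hj hjb => vert j hj hjb (Or.inl h1)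
    · refine Int.eq_of_forall_succ_eq (f := fun x => L x a2) (by omega) fun i hi hib => ?_
      refine hL.fst_miss _ _ fun z hz hzE => ?_
      have := hmin _ hzE _ hb
      rw [Prod.mk_inf_mk, inf_eq_left.2 hib.le] at this
      have h3 : a2 ≤ z ⊓ b2 := le_inf hz (by omega)
      have h4 : z ⊓ b2 ≤ b2 := inf_le_right
      exact hcons _ _ this (by omega)

theorem IsLevelFn.eq_add_of_isSatChain {E : Set Z2} {L : ℤ → ℤ → ℤ} (hL : IsLevelFn E L)
    (hmin : MinClosed E) {n : ℕ} {f : ℕ → Z2} (hf : IsSatChain E n f) :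
    L (f n).1 (f n).2 = L (f 0).1 (f 0).2 + n := by
  obtain ⟨hmem, hlt, hcons⟩ := hf
  suffices ∀ k ≤ n, L (f k).1 (f k).2 = L (f 0).1 (f 0).2 + k from this n le_rfl
  intro k
  induction k with
  | zero => simp
  | succ k ih =>
    intro hk
    rw [hL.eq_add_one_of_consecutive hmin (hmem k (by omega)) (hmem (k + 1) hk)
      (hlt k (by omega)) (hcons k (by omega)), ih (by omega)]
    push_cast
    ring

theorem exists_isSatChain {E : Set Z2} {b : Z2} (hb : b ∈ E) (a : Z2) (ha : a ∈ E)
    (hab : a ≤ b) : ∃ n f, IsSatChain E n f ∧ f 0 = a ∧ f n = b := by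
  induction hk : ((b.1 - a.1) + (b.2 - a.2)).toNat using Nat.strong_induction_on generalizing a with
  | _ k ih =>
    rcases hab.eq_or_lt with rfl | hlt
    · exact ⟨0, fun _ => a, ⟨fun _ _ => ha, by simp, by simp⟩, rfl, rfl⟩
    · have hfin : {x | x ∈ E ∧ a < x ∧ x ≤ b}.Finite :=
        (Set.finite_Icc a b).subset fun x hx => ⟨hx.2.1.le, hx.2.2⟩
      obtain ⟨s, hs⟩ := hfin.exists_minimal ⟨b, hb, hlt, le_rfl⟩
      obtain ⟨hsE, has, hsb⟩ := hs.prop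
      have hdec : ((b.1 - s.1) + (b.2 - s.2)).toNat < k := by
        rw [Prod.lt_iff] at has
        rw [Prod.le_def] at hsb
        omega
      obtain ⟨n, f, ⟨h1, h2, h3⟩, hf0, hfn⟩ := ih _ hdec s hsE hsb rfl
      refine ⟨n + 1, fun i => Nat.casesOn i a f, ⟨?_, ?_, ?_⟩, rfl, hfn⟩
      · rintro (_ | i) hi
        · exact ha
        · exact h1 i (by omega)
      · rintro (_ | i) hi
        · exact has.trans_eq hf0.symm
        · exact h2 i (by omega)
      · rintro (_ | i) hi c hc ⟨hc1, hc2⟩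
        · have hcs : c < s := hc2.trans_eq hf0
          exact hs.not_lt ⟨hc, hc1, hcs.le.trans hsb⟩ hcs
        · exact h3 i (by omega) c hc ⟨hc1, hc2⟩

theorem IsLevelFn.chainDist_eq {E : Set Z2} {L : ℤ → ℤ → ℤ} (hL : IsLevelFn E L)
    (hmin : MinClosed E) {a b : Z2} (ha : a ∈ E) (hb : b ∈ E) (hab : a ≤ b) :
    (chainDist E a b : ℤ) = L b.1 b.2 - L a.1 a.2 := by
  obtain ⟨n, f, hf, hf0, hfn⟩ := exists_isSatChain hb a ha hab
  have hn := hL.eq_add_of_isSatChain hmin hf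
  rw [hf0, hfn] at hn
  have hset : {n : ℕ | ∃ f : ℕ → Z2, IsSatChain E n f ∧ f 0 = a ∧ f n = b} = {n} := by
    ext m
    constructor
    · rintro ⟨g, hg, hg0, hgm⟩
      have hm := hL.eq_add_of_isSatChain hmin hg
      rw [hg0, hgm] at hm
      simp only [Set.mem_singleton_iff]
      omega
    · rintro rfl
      exact ⟨f, hf, hf0, hfn⟩
  rw [chainDist, hset, csSup_singleton]
  omega

theorem minEl_eq {E : Set Z2} {m : Z2} (hm : m ∈ E) (hle : ∀ a ∈ E, m ≤ a) : minEl E = m := by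
  have h1 : IsLeast (Prod.fst '' E) m.1 :=
    ⟨⟨m, hm, rfl⟩, by rintro _ ⟨a, ha, rfl⟩; exact (hle a ha).1⟩
  have h2 : IsLeast (Prod.snd '' E) m.2 :=
    ⟨⟨m, hm, rfl⟩, by rintro _ ⟨a, ha, rfl⟩; exact (hle a ha).2⟩
  rw [minEl, h1.csInf_eq, h2.csInf_eq]

theorem minClosed_orthant (c : Z2) : MinClosed (Set.Ici c) :=
  fun _ ha _ hb => Set.mem_Ici.2 (le_inf ha hb)

theorem chainDist_orthant {c a : Z2} (h : c ≤ a) :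
    (chainDist (Set.Ici c) c a : ℤ) = (a.1 - c.1) + (a.2 - c.2) := by
  rw [(isLevelFn_orthant c).chainDist_eq (minClosed_orthant c) Set.self_mem_Ici h h]
  have := h.1
  have := h.2
  omega

theorem dist2_eq {E F : Set Z2} {c : Z2} {z : ℤ} (hF : ∀ y, c ≤ y → y ∈ F)
    (h : ∀ a, c ≤ a →
      (chainDist E (minEl E) a : ℤ) - (chainDist F (minEl F) a : ℤ) = z) :
    dist2 E F = z := by
  have hset : {z : ℤ | ∃ β : Z2, ∀ α ∈ F, β ≤ α →
      (chainDist E (minEl E) α : ℤ) - (chainDist F (minEl F) α : ℤ) = z} = {z} := by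
    ext w
    constructor
    · rintro ⟨β, hβ⟩
      exact (hβ (β ⊔ c) (hF _ le_sup_right) le_sup_left).symm.trans (h _ le_sup_right)
    · rintro rfl
      exact ⟨c, fun a _ ha => h a ha⟩
  rw [dist2, hset, csSup_singleton]

theorem orth_eq_Ici : orth = Set.Ici (0 : Z2) := by
  ext b
  exact Iff.rfl

theorem IsGood.condE_spec {S : Set Z2} (hS : IsGood S) :
    (∀ y, condE S ≤ y → y ∈ S) ∧ ∀ δ : Z2, (∀ y, δ ≤ y → y ∈ S) → condE S ≤ δ := by
  obtain ⟨h0, -, -, hmin, ⟨δ, hδ⟩, -⟩ := hS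
  set T := {δ : Z2 | ∀ y : Z2, δ ≤ y → y ∈ S}
  have hT0 : ∀ d ∈ T, d ∈ orth := fun d hd => h0 (hd d le_rfl)
  have b1 : BddBelow ((fun δ : Z2 => δ.1) '' T) :=
    ⟨0, by rintro _ ⟨d, hd, rfl⟩; exact (hT0 d hd).1⟩
  have b2 : BddBelow ((fun δ : Z2 => δ.2) '' T) :=
    ⟨0, by rintro _ ⟨d, hd, rfl⟩; exact (hT0 d hd).2⟩
  have n1 : ((fun δ : Z2 => δ.1) '' T).Nonempty := ⟨_, δ, hδ, rfl⟩
  have n2 : ((fun δ : Z2 => δ.2) '' T).Nonempty := ⟨_, δ, hδ, rfl⟩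
  obtain ⟨u, hu, hu'⟩ := Int.csInf_mem n1 b1
  obtain ⟨v, hv, hv'⟩ := Int.csInf_mem n2 b2
  have hc : condE S = (u.1, v.2) := Prod.ext hu'.symm hv'.symm
  refine ⟨fun y hy => ?_, fun d hd => ⟨csInf_le b1 ⟨d, hd, rfl⟩, csInf_le b2 ⟨d, hd, rfl⟩⟩⟩
  rw [hc] at hy
  have e1 : (y.1, max y.2 u.2) ∈ S := hu _ ⟨hy.1, le_max_right _ _⟩
  have e2 : (max y.1 v.1, y.2) ∈ S := hv _ ⟨le_max_right _ _, hy.2⟩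
  have := hmin _ e1 _ e2
  rwa [Prod.mk_inf_mk, inf_eq_left.2 (le_max_left _ _), inf_eq_right.2 (le_max_left _ _)] at this

theorem IsGood.frobenius_fst_notMem {S : Set Z2} (hS : IsGood S) {y : ℤ}
    (hy : (condE S).2 ≤ y) : ((condE S).1 - 1, y) ∉ S := by
  intro hmem
  obtain ⟨hc, hleast⟩ := hS.condE_spec
  obtain ⟨-, -, -, hmin, -, hG3⟩ := hS
  set c := condE S
  have hlarge : ∀ n, y ≤ n → ∃ z, n ≤ z ∧ (c.1 - 1, z) ∈ S := by
    intro n hn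
    induction n, hn using Int.leInduction with
    | base => exact ⟨y, le_rfl, hmem⟩
    | succ n hn ih =>
      obtain ⟨z, hz, hzS⟩ := ih
      have hb : (c.1, z) ∈ S := hc _ ⟨le_rfl, by dsimp only; omega⟩
      obtain ⟨w, hw, hwS⟩ := (hG3.square _ _ hzS).2 ⟨c.1, by omega, hb⟩
      exact ⟨w, by omega, hwS⟩
  have : c ≤ (c.1 - 1, c.2) := by
    refine hleast _ fun w hw => ?_
    rcases lt_or_ge w.1 c.1 with h | h
    · obtain ⟨z, hz, hzS⟩ := hlarge (max y w.2) (le_max_left _ _)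
      have hb : (c.1, w.2) ∈ S := hc _ ⟨le_rfl, hw.2⟩
      have hm := hmin _ hzS _ hb
      rw [Prod.mk_inf_mk, inf_eq_left.2 (by omega), inf_eq_right.2 (by omega)] at hm
      have h1 := hw.1
      dsimp only at h1
      rwa [show c.1 - 1 = w.1 by omega] at hm
    · exact hc _ ⟨h, hw.2⟩
  have := this.1
  dsimp only at this
  omega

theorem IsGood.frobenius_snd_notMem {S : Set Z2} (hS : IsGood S) {x : ℤ}
    (hx : (condE S).1 ≤ x) : (x, (condE S).2 - 1) ∉ S := by
  intro hmem
  obtain ⟨hc, hleast⟩ := hS.condE_spec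
  obtain ⟨-, -, -, hmin, -, hG3⟩ := hS
  set c := condE S
  have hlarge : ∀ n, x ≤ n → ∃ z, n ≤ z ∧ (z, c.2 - 1) ∈ S := by
    intro n hn
    induction n, hn using Int.leInduction with
    | base => exact ⟨x, le_rfl, hmem⟩
    | succ n hn ih =>
      obtain ⟨z, hz, hzS⟩ := ih
      have hb : (z, c.2) ∈ S := hc _ ⟨by dsimp only; omega, le_rfl⟩
      obtain ⟨w, hw, hwS⟩ := (hG3.square _ _ hzS).1 ⟨c.2, by omega, hb⟩
      exact ⟨w, by omega, hwS⟩
  have : c ≤ (c.1, c.2 - 1) := by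
    refine hleast _ fun w hw => ?_
    rcases lt_or_ge w.2 c.2 with h | h
    · obtain ⟨z, hz, hzS⟩ := hlarge (max x w.1) (le_max_left _ _)
      have hb : (w.1, c.2) ∈ S := hc _ ⟨hw.1, le_rfl⟩
      have hm := hmin _ hzS _ hb
      rw [Prod.mk_inf_mk, inf_eq_right.2 (by omega), inf_eq_left.2 (by omega)] at hm
      have h1 := hw.2
      dsimp only at h1
      rwa [show c.2 - 1 = w.2 by omega] at hm
    · exact hc _ ⟨hw.1, h⟩
  have := this.2
  dsimp only at this
  omega

/-- If, past its first level, a set admits no element around which a monotone function bounded by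
`M` is locally constant in both directions, then each further level costs one unit below `M`. -/
theorem add_level_le {A : Set Z2} {φ : ℤ → ℤ → ℤ} {M : ℤ}
    (hfst : ∀ y, Monotone fun x => φ x y) (hsnd : ∀ x, Monotone (φ x)) (hM : ∀ x y, φ x y ≤ M)
    (hstep : ∀ x y, (x, y) ∈ A \ NLrem A 1 →
      φ x y + 1 ≤ φ (x + 1) y ∨ φ x y + 1 ≤ φ x (y + 1)) (i : ℕ) :
    ∀ x y, (x, y) ∈ A \ NLrem A (i + 1) → φ x y + i + 1 ≤ M := by
  induction i with
  | zero =>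
    intro x y h
    have h1 := hM (x + 1) y
    have h2 := hM x (y + 1)
    have h3 := hstep x y h
    push_cast
    omega
  | succ i ih =>
    rintro x y ⟨hA, hn⟩
    set R := A \ NLrem A (i + 1)
    have hnR : (x, y) ∉ NLrem A (i + 1) := fun h => hn (Or.inl h)
    have hnD : (x, y) ∉ Dof R := fun h => hn (Or.inr h)
    have hsub : ∀ k, NLrem A 1 ⊆ NLrem A (k + 1) := by
      intro k
      induction k with
      | zero => exact le_rfl
      | succ k ihk => exact ihk.trans Set.subset_union_left
    have hs := hstep x y ⟨hA, fun h => hnR (hsub i h)⟩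
    have hmono : ∀ {x x' y y'}, x ≤ x' → y ≤ y' → φ x y ≤ φ x' y' :=
      fun h h' => (hfst _ h).trans (hsnd _ h')
    by_cases hB : (x, y) ∈ Bof R
    · have hC : (x, y) ∈ Cof (Bof R) := by
        by_contra hC
        exact hnD ⟨hB, hC⟩
      obtain ⟨-, ⟨b1, b2⟩, hb, ⟨c1, c2⟩, hc, hbne, hcne, heq⟩ := hC
      rw [Prod.mk_inf_mk] at heq
      simp only [ne_eq, Prod.mk.injEq] at heq hbne hcne
      have i1 := ih _ _ hb.1
      have i2 := ih _ _ hc.1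
      obtain ⟨e1, e2⟩ := heq
      have hcases : (x + 1 ≤ b1 ∧ y ≤ b2 ∧ x ≤ c1 ∧ y + 1 ≤ c2) ∨
          (x + 1 ≤ c1 ∧ y ≤ c2 ∧ x ≤ b1 ∧ y + 1 ≤ b2) := by
        omega
      push_cast
      rcases hcases with ⟨h1, h2, h3, h4⟩ | ⟨h1, h2, h3, h4⟩ <;>
      · have := hmono h1 h2
        have := hmono h3 h4
        omega
    · obtain ⟨⟨b1, b2⟩, hb, h1, h2⟩ : ∃ b ∈ R, llt (x, y) b := by
        by_contra hcon
        exact hB ⟨⟨hA, hnR⟩, fun b hb hlt => hcon ⟨b, hb, hlt⟩⟩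
      dsimp only at h1 h2
      have i1 := ih _ _ hb
      have := hmono (show x + 1 ≤ b1 by omega) (show y ≤ b2 by omega)
      have := hmono (show x ≤ b1 by omega) (show y + 1 ≤ b2 by omega)
      push_cast
      omega

theorem IsLocal.one_le {S : Set Z2} (hS : IsGood S) (hl : IsLocal S) {m : Z2} (hm : m ∈ S)
    (h0 : m ≠ 0) : 1 ≤ m.1 ∧ 1 ≤ m.2 := by
  have h1 := (hS.1 hm).1
  have h2 := (hS.1 hm).2
  have h3 : ¬ (m.1 = 0 ∨ m.2 = 0) := fun h => h0 (hl m hm h)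
  omega

theorem IsLocal.one_le_condE {S : Set Z2} (hS : IsGood S) (hl : IsLocal S) :
    1 ≤ (condE S).1 ∧ 1 ≤ (condE S).2 := by
  have hc := hS.condE_spec.1
  have h0 := hS.1 (hc _ le_rfl)
  have h1 := hl.one_le hS (hc (condE S + (0, 1)) ⟨by simp, by simp⟩) fun h => by
    have := congrArg Prod.snd h
    have := h0.2
    simp at *
    omega
  have h2 := hl.one_le hS (hc (condE S + (1, 0)) ⟨by simp, by simp⟩) fun h => by
    have := congrArg Prod.fst h
    have := h0.1
    simp at *
    omega
  simp only [Prod.fst_add, Prod.snd_add, add_zero] at h1 h2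
  exact ⟨h1.1, h2.2⟩

theorem mem_NLrem_one {A : Set Z2} {a : Z2} (h : a ∈ Dof A) : a ∈ NLrem A 1 := by
  refine Or.inr ?_
  rwa [NLrem, Set.sdiff_empty]

/-- The Frobenius strips `{(c₁ - 1, y) : y ≥ c₂}` lie in the first level of `PF(S)`. -/
theorem IsLocal.frobenius_fst_mem_level {S : Set Z2} (hS : IsGood S) (hl : IsLocal S) {y : ℤ}
    (hy : (condE S).2 ≤ y) : ((condE S).1 - 1, y) ∈ NLrem (PFset S) 1 := by
  have hc := hS.condE_spec.1
  have h1 := hl.one_le_condE hS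
  have hPF : ((condE S).1 - 1, y) ∈ PFset S := by
    refine ⟨⟨by dsimp only; omega, by dsimp only; omega⟩, hS.frobenius_fst_notMem hy,
      fun m hm h0 => hc _ ?_⟩
    have := hl.one_le hS hm h0
    exact ⟨by dsimp; omega, by dsimp; omega⟩
  refine mem_NLrem_one ⟨⟨hPF, fun b hb hlt => hb.2.1 (hc b ?_)⟩, ?_⟩
  · obtain ⟨h2, h3⟩ := hlt
    exact ⟨by dsimp at *; omega, by dsimp at *; omega⟩
  · rintro ⟨-, ⟨b1, b2⟩, hb, ⟨c1, c2⟩, hd, hbne, hcne, heq⟩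
    rw [Prod.mk_inf_mk] at heq
    simp only [ne_eq, Prod.mk.injEq] at heq hbne hcne
    obtain ⟨e1, e2⟩ := heq
    rcases show ((condE S).1 ≤ b1 ∧ (condE S).2 ≤ b2) ∨ ((condE S).1 ≤ c1 ∧ (condE S).2 ≤ c2) by
      omega with h | h
    · exact hb.1.2.1 (hc _ h)
    · exact hd.1.2.1 (hc _ h)

/-- The Frobenius strips `{(x, c₂ - 1) : x ≥ c₁}` lie in the first level of `PF(S)`. -/
theorem IsLocal.frobenius_snd_mem_level {S : Set Z2} (hS : IsGood S) (hl : IsLocal S) {x : ℤ}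
    (hx : (condE S).1 ≤ x) : (x, (condE S).2 - 1) ∈ NLrem (PFset S) 1 := by
  have hc := hS.condE_spec.1
  have h1 := hl.one_le_condE hS
  have hPF : (x, (condE S).2 - 1) ∈ PFset S := by
    refine ⟨⟨by dsimp only; omega, by dsimp only; omega⟩, hS.frobenius_snd_notMem hx,
      fun m hm h0 => hc _ ?_⟩
    have := hl.one_le hS hm h0
    exact ⟨by dsimp; omega, by dsimp; omega⟩
  refine mem_NLrem_one ⟨⟨hPF, fun b hb hlt => hb.2.1 (hc b ?_)⟩, ?_⟩
  · obtain ⟨h2, h3⟩ := hlt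
    exact ⟨by dsimp at *; omega, by dsimp at *; omega⟩
  · rintro ⟨-, ⟨b1, b2⟩, hb, ⟨c1, c2⟩, hd, hbne, hcne, heq⟩
    rw [Prod.mk_inf_mk] at heq
    simp only [ne_eq, Prod.mk.injEq] at heq hbne hcne
    obtain ⟨e1, e2⟩ := heq
    rcases show ((condE S).1 ≤ b1 ∧ (condE S).2 ≤ b2) ∨ ((condE S).1 ≤ c1 ∧ (condE S).2 ≤ c2) by
      omega with h | h
    · exact hb.1.2.1 (hc _ h)
    · exact hd.1.2.1 (hc _ h)

section LevelFn

variable {S : Set Z2} {L : ℤ → ℤ → ℤ}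

theorem IsLevelFn.eq_of_condE_le (hL : IsLevelFn S L) (hS : IsGood S) {x y : ℤ}
    (hx : (condE S).1 ≤ x) (hy : (condE S).2 ≤ y) :
    L x y = L (condE S).1 (condE S).2 + (x - (condE S).1) + (y - (condE S).2) := by
  have hc := hS.condE_spec.1
  set c := condE S
  have h1 : L x y - y = L x c.2 - c.2 :=
    Int.eq_of_forall_succ_eq (f := fun y => L x y - y) hy fun j hj _ => by
      rw [hL.snd_hit x j x le_rfl (hc _ ⟨hx, hj⟩)]
      ring
  have h2 : L x c.2 - x = L c.1 c.2 - c.1 :=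
    Int.eq_of_forall_succ_eq (f := fun x => L x c.2 - x) hx fun j hj _ => by
      rw [hL.fst_hit j c.2 c.2 le_rfl (hc _ ⟨hj, le_rfl⟩)]
      ring
  omega

theorem IsLevelFn.eq_of_nonpos (hL : IsLevelFn S L) (hS : S ⊆ orth) {x y : ℤ}
    (hx : x ≤ 0) (hy : y ≤ 0) : L x y = L 0 0 := by
  have h1 : L x 0 = L x y :=
    Int.eq_of_forall_succ_eq (f := L x) hy fun j _ hj =>
      hL.snd_miss _ _ fun z _ hz => by
        have := (hS hz).2
        dsimp only at this
        omega
  have h2 : L 0 0 = L x 0 :=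
    Int.eq_of_forall_succ_eq (f := fun x => L x 0) hx fun j _ hj =>
      hL.fst_miss _ _ fun z _ hz => by
        have := (hS hz).1
        dsimp only at this
        omega
  omega

theorem IsLevelFn.genus_eq (hL : IsLevelFn S L) (hS : IsGood S) :
    genus S = (condE S).1 + (condE S).2 - (L (condE S).1 (condE S).2 - L 0 0) := by
  have hc := hS.condE_spec.1
  refine dist2_eq hc fun a ha => ?_
  have h0 : (0 : Z2) ≤ a := hS.1 (hc a ha)
  rw [minEl_eq hS.2.1 fun b hb => hS.1 hb, orth_eq_Ici,
    minEl_eq Set.self_mem_Ici fun b hb => hb, chainDist_orthant h0,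
    hL.chainDist_eq hS.2.2.2.1 hS.2.1 (hc a ha) h0, hL.eq_of_condE_le hS ha.1 ha.2]
  simp only [Prod.fst_zero, Prod.snd_zero]
  ring

theorem IsLevelFn.glen_eq (hL : IsLevelFn S L) (hS : IsGood S) :
    glen S = L (condE S).1 (condE S).2 - L 0 0 := by
  have hc := hS.condE_spec.1
  have hC : CIdeal S = Set.Ici (condE S) := by
    ext b
    exact ⟨fun h => h.2, fun h => ⟨hc b h, h⟩⟩
  rw [glen, hC]
  refine dist2_eq (c := condE S) (fun y hy => hy) fun a ha => ?_
  have h0 : (0 : Z2) ≤ a := hS.1 (hc a ha)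
  rw [minEl_eq hS.2.1 fun b hb => hS.1 hb, minEl_eq Set.self_mem_Ici fun b hb => hb,
    chainDist_orthant ha, hL.chainDist_eq hS.2.2.2.1 hS.2.1 (hc a ha) h0,
    hL.eq_of_condE_le hS ha.1 ha.2]
  simp only [Prod.fst_zero, Prod.snd_zero]
  ring

theorem IsLevelFn.fst_cases (hL : IsLevelFn S L) (x y : ℤ) :
    ((∃ z, y ≤ z ∧ (x, z) ∈ S) ∧ L (x + 1) y = L x y + 1) ∨
      ((∀ z, y ≤ z → (x, z) ∉ S) ∧ L (x + 1) y = L x y) := by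
  by_cases h : ∃ z, y ≤ z ∧ (x, z) ∈ S
  · obtain ⟨z, hz, hzS⟩ := h
    exact Or.inl ⟨⟨z, hz, hzS⟩, hL.fst_hit x y z hz hzS⟩
  · push Not at h
    exact Or.inr ⟨h, hL.fst_miss x y h⟩

theorem IsLevelFn.snd_cases (hL : IsLevelFn S L) (x y : ℤ) :
    ((∃ z, x ≤ z ∧ (z, y) ∈ S) ∧ L x (y + 1) = L x y + 1) ∨
      ((∀ z, x ≤ z → (z, y) ∉ S) ∧ L x (y + 1) = L x y) := by
  by_cases h : ∃ z, x ≤ z ∧ (z, y) ∈ S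
  · obtain ⟨z, hz, hzS⟩ := h
    exact Or.inl ⟨⟨z, hz, hzS⟩, hL.snd_hit x y z hz hzS⟩
  · push Not at h
    exact Or.inr ⟨h, hL.snd_miss x y h⟩

/-- The difference between the level functions of the canonical ideal of `S` and of `S`, the
former being obtained from `L` by reflection at the conductor `c`. -/
def canonicalGap (L : ℤ → ℤ → ℤ) (c : Z2) (x y : ℤ) : ℤ :=
  x + y + L (c.1 - x) (c.2 - y) - L c.1 c.2 - (L x y - L 0 0)

theorem IsLevelFn.canonicalGap_mono_fst (hL : IsLevelFn S L) (hS : IsGood S) (y : ℤ) :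
    Monotone fun x => canonicalGap L (condE S) x y := by
  refine monotone_int_of_le_succ fun x => ?_
  simp only [canonicalGap]
  have h1 := hL.fst_cases x y
  have h2 := hL.fst_cases ((condE S).1 - (x + 1)) ((condE S).2 - y)
  rw [show (condE S).1 - (x + 1) + 1 = (condE S).1 - x by ring] at h2
  rcases h1 with ⟨⟨z, hz, hzS⟩, h1⟩ | ⟨-, h1⟩ <;> rcases h2 with ⟨⟨w, hw, hwS⟩, h2⟩ | ⟨-, h2⟩
  · have hsum := hS.2.2.1 _ hzS _ hwS
    rw [Prod.mk_add_mk, show x + ((condE S).1 - (x + 1)) = (condE S).1 - 1 by ring] at hsum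
    exact absurd hsum (hS.frobenius_fst_notMem (by omega))
  all_goals omega

theorem IsLevelFn.canonicalGap_mono_snd (hL : IsLevelFn S L) (hS : IsGood S) (x : ℤ) :
    Monotone (canonicalGap L (condE S) x) := by
  refine monotone_int_of_le_succ fun y => ?_
  simp only [canonicalGap]
  have h1 := hL.snd_cases x y
  have h2 := hL.snd_cases ((condE S).1 - x) ((condE S).2 - (y + 1))
  rw [show (condE S).2 - (y + 1) + 1 = (condE S).2 - y by ring] at h2
  rcases h1 with ⟨⟨z, hz, hzS⟩, h1⟩ | ⟨-, h1⟩ <;> rcases h2 with ⟨⟨w, hw, hwS⟩, h2⟩ | ⟨-, h2⟩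
  · have hsum := hS.2.2.1 _ hzS _ hwS
    rw [Prod.mk_add_mk, show y + ((condE S).2 - (y + 1)) = (condE S).2 - 1 by ring] at hsum
    exact absurd hsum (hS.frobenius_snd_notMem (by omega))
  all_goals omega

theorem IsLevelFn.canonicalGap_le (hL : IsLevelFn S L) (hS : IsGood S) (x y : ℤ) :
    canonicalGap L (condE S) x y ≤ genus S - glen S := by
  have h1 := hL.canonicalGap_mono_fst hS y (le_max_left x (condE S).1)
  have h2 := hL.canonicalGap_mono_snd hS (max x (condE S).1) (le_max_left y (condE S).2)
  refine (h1.trans h2).trans ?_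
  rw [hL.genus_eq hS, hL.glen_eq hS, canonicalGap,
    hL.eq_of_condE_le hS (le_max_right _ _) (le_max_right _ _),
    hL.eq_of_nonpos hS.1 (by omega) (by omega)]
  omega

theorem IsLevelFn.canonicalGap_step (hL : IsLevelFn S L) (hS : IsGood S) (hl : IsLocal S)
    (x y : ℤ) (h : (x, y) ∈ PFset S \ NLrem (PFset S) 1) :
    canonicalGap L (condE S) x y + 1 ≤ canonicalGap L (condE S) (x + 1) y ∨
      canonicalGap L (condE S) x y + 1 ≤ canonicalGap L (condE S) x (y + 1) := by
  obtain ⟨⟨-, hnS, hPF⟩, hlev⟩ := h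
  have d1 := hL.fst_miss ((condE S).1 - (x + 1)) ((condE S).2 - y) fun z hz hzS => by
    by_cases h0 : ((condE S).1 - (x + 1), z) = (0 : Z2)
    · obtain ⟨e1, e2⟩ := Prod.mk.inj h0
      have := hl.frobenius_fst_mem_level hS (y := y) (by omega)
      rw [show (condE S).1 - 1 = x by omega] at this
      exact hlev this
    · have := hPF _ hzS h0
      rw [Prod.mk_add_mk, show x + ((condE S).1 - (x + 1)) = (condE S).1 - 1 by ring] at this
      exact hS.frobenius_fst_notMem (by omega) this
  have d2 := hL.snd_miss ((condE S).1 - x) ((condE S).2 - (y + 1)) fun z hz hzS => by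
    by_cases h0 : (z, (condE S).2 - (y + 1)) = (0 : Z2)
    · obtain ⟨e1, e2⟩ := Prod.mk.inj h0
      have := hl.frobenius_snd_mem_level hS (x := x) (by omega)
      rw [show (condE S).2 - 1 = y by omega] at this
      exact hlev this
    · have := hPF _ hzS h0
      rw [Prod.mk_add_mk, show y + ((condE S).2 - (y + 1)) = (condE S).2 - 1 by ring] at this
      exact hS.frobenius_snd_notMem (by omega) this
  rw [show (condE S).1 - (x + 1) + 1 = (condE S).1 - x by ring] at d1
  rw [show (condE S).2 - (y + 1) + 1 = (condE S).2 - y by ring] at d2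
  simp only [canonicalGap]
  rcases hL.fst_cases x y with ⟨⟨z, hz, hzS⟩, h1⟩ | ⟨-, h1⟩
  · rcases hL.snd_cases x y with ⟨⟨w, hw, hwS⟩, h2⟩ | ⟨-, h2⟩
    · have := hS.2.2.2.1 _ hzS _ hwS
      rw [Prod.mk_inf_mk, inf_eq_left.2 hw, inf_eq_right.2 hz] at this
      exact absurd this hnS
    · right
      omega
  · left
    omega

end LevelFn

/-- For every local good semigroup `S ⊆ ℕ²`,
`g(S) ≥ t(S) + l(S) − 1`. -/
theorem genus_ge_type_add_length_sub_one (S : Set Z2) (hS : IsGood S)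
    (hl : IsLocal S) :
    (typ S : ℤ) + glen S - 1 ≤ genus S := by
  obtain ⟨L, hL⟩ := hS.2.2.2.2.2.exists_isLevelFn hS.1
  have hle := hL.canonicalGap_le hS
  have hnonneg : ∀ x y, 0 ≤ x → 0 ≤ y → 0 ≤ canonicalGap L (condE S) x y := by
    intro x y hx hy
    have h0 : canonicalGap L (condE S) 0 0 = 0 := by simp [canonicalGap]
    exact h0.ge.trans
      ((hL.canonicalGap_mono_fst hS 0 hx).trans (hL.canonicalGap_mono_snd hS x hy))
  have hM : 0 ≤ genus S - glen S := (hnonneg 0 0 le_rfl le_rfl).trans (hle 0 0)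
  have htyp : typ S ≤ (genus S - glen S).toNat + 1 := by
    refine Nat.sInf_le ?_
    rintro ⟨x, y⟩ ha
    by_contra hn
    have h1 := add_level_le (hL.canonicalGap_mono_fst hS) (hL.canonicalGap_mono_snd hS) hle
      (hL.canonicalGap_step hS hl) _ x y ⟨ha, hn⟩
    have h2 := hnonneg x y ha.1.1 ha.1.2
    omega
  omega
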